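/- Suppose N' ≥ 4. For every integer 2 ≤ m ≤ N', P(#{𝔭(u_1), …, 𝔭(u_m)} ≤ m − 1) ≥ binom(m,2) · P(𝔭(u_1) = 𝔭(u_2)) − 3·binom(m,3) · P(𝔭(u_1) = 𝔭(u_2) = 𝔭(u_3)) − 6·binom(m,4) · P(𝔭(u_1) = 𝔭(u_2) and 𝔭(u_3) = 𝔭(u_4)). -/

import Mathlib

open MeasureTheory Finset
open scoped ENNReal

/-- The parent map associated with an offspring vector `v`. -/
noncomputable def parentMap (v : ℕ → ℕ) (c : ℕ) : ℕ :=
  sInf {i : ℕ | c < ∑ j ∈ Finset.range (i + 1), v j}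

/-- The value of a permutation of `Fin M` at position `i < M`, and `0` otherwise. -/
def permVal {M : ℕ} (e : Equiv.Perm (Fin M)) (i : ℕ) : ℕ :=
  if h : i < M then (e ⟨i, h⟩ : Fin M) else 0


theorem meas_parent (c : ℕ) : Measurable (fun v : ℕ → ℕ => parentMap v c) := by
  have hA : ∀ k : ℕ, MeasurableSet {v : ℕ → ℕ | c < ∑ j ∈ Finset.range (k + 1), v j} := by
    intro k
    apply measurableSet_lt measurable_const
    exact Finset.measurable_sum _ (fun j _ => measurable_pi_apply j)
  apply measurable_to_countable'
  intro n
  have : (fun v : ℕ → ℕ => parentMap v c) ⁻¹' {n} =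
      {v | (c < ∑ j ∈ Finset.range (n + 1), v j ∧
        ∀ k, k < n → ¬ c < ∑ j ∈ Finset.range (k + 1), v j) ∨
        (n = 0 ∧ ∀ k, ¬ c < ∑ j ∈ Finset.range (k + 1), v j)} := by
    ext v
    simp only [Set.mem_preimage, Set.mem_singleton_iff, Set.mem_ofPred_eq, parentMap]
    constructor
    · rintro rfl
      by_cases h : {i : ℕ | c < ∑ j ∈ Finset.range (i + 1), v j}.Nonempty
      · left
        exact ⟨Nat.sInf_mem h, fun k hk => Nat.notMem_of_lt_sInf
          (s := {i : ℕ | c < ∑ j ∈ Finset.range (i + 1), v j}) hk⟩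
      · right
        rw [Set.not_nonempty_iff_eq_empty] at h
        refine ⟨by rw [h]; simp, fun k hk => ?_⟩
        have : k ∈ {i : ℕ | c < ∑ j ∈ Finset.range (i + 1), v j} := hk
        rw [h] at this
        exact this
    · rintro (⟨h1, h2⟩ | ⟨rfl, h⟩)
      · apply le_antisymm (Nat.sInf_le (s := {i : ℕ | c < ∑ j ∈ Finset.range (i + 1), v j}) h1)
        by_contra hlt
        exact h2 _ (not_le.mp hlt) (Nat.sInf_mem
          (s := {i : ℕ | c < ∑ j ∈ Finset.range (i + 1), v j}) ⟨n, h1⟩)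
      · rw [Nat.sInf_eq_zero]
        right
        ext k
        simpa using h k
  rw [this]
  refine MeasurableSet.union (MeasurableSet.inter (hA n) ?_) (MeasurableSet.inter (.const _) ?_)
  · have : {v : ℕ → ℕ | ∀ k, k < n → ¬ c < ∑ j ∈ Finset.range (k + 1), v j} =
      ⋂ k, ⋂ (_ : k < n), {v : ℕ → ℕ | c < ∑ j ∈ Finset.range (k + 1), v j}ᶜ := by
      ext v; simp
    change MeasurableSet {v : ℕ → ℕ | ∀ k, k < n → ¬ c < ∑ j ∈ Finset.range (k + 1), v j}
    rw [this]
    exact MeasurableSet.iInter fun k => MeasurableSet.iInter fun _ => (hA k).compl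
  · have : {v : ℕ → ℕ | ∀ k, ¬ c < ∑ j ∈ Finset.range (k + 1), v j} =
      ⋂ k, {v : ℕ → ℕ | c < ∑ j ∈ Finset.range (k + 1), v j}ᶜ := by
      ext v; simp
    change MeasurableSet {v : ℕ → ℕ | ∀ k, ¬ c < ∑ j ∈ Finset.range (k + 1), v j}
    rw [this]
    exact MeasurableSet.iInter fun k => (hA k).compl

theorem prob_sum {Ω : Type*} [MeasurableSpace Ω] (P : Measure Ω) (N' : ℕ)
    (ν : Ω → ℕ → ℕ) (hνmeas : Measurable ν)
    (σ : Ω → Equiv.Perm (Fin N'))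
    (hσmeas : ∀ e, MeasurableSet {ω | σ ω = e})
    (hσunif : ∀ e : Equiv.Perm (Fin N'),
      P {ω | σ ω = e} = 1 / (Nat.factorial N' : ℝ≥0∞))
    (hindep : ∀ (e : Equiv.Perm (Fin N')) (S : Set (ℕ → ℕ)), MeasurableSet S →
      P ({ω | σ ω = e} ∩ ν ⁻¹' S) = P {ω | σ ω = e} * P (ν ⁻¹' S))
    (Q : (ℕ → ℕ) → Equiv.Perm (Fin N') → Prop) (hQ : ∀ e, MeasurableSet {v | Q v e}) :
    P {ω | Q (ν ω) (σ ω)} = ∑ e, 1 / (Nat.factorial N' : ℝ≥0∞) * P (ν ⁻¹' {v | Q v e}) := by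
  have : {ω | Q (ν ω) (σ ω)} = ⋃ e ∈ (Finset.univ : Finset (Equiv.Perm (Fin N'))),
      ({ω | σ ω = e} ∩ ν ⁻¹' {v | Q v e}) := by
    ext ω; simp
  rw [this, measure_biUnion_finset]
  · exact Finset.sum_congr rfl fun e _ => by rw [hindep e _ (hQ e), hσunif]
  · intro e _ e' _ h
    apply Set.disjoint_left.mpr
    rintro ω ⟨h1, _⟩ ⟨h2, _⟩
    exact h (h1.symm.trans h2)
  · exact fun e _ => (hσmeas e).inter (hνmeas (hQ e))

theorem prob_inv {Ω : Type*} [MeasurableSpace Ω] (P : Measure Ω) (N' : ℕ)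
    (ν : Ω → ℕ → ℕ) (hνmeas : Measurable ν)
    (σ : Ω → Equiv.Perm (Fin N'))
    (hσmeas : ∀ e, MeasurableSet {ω | σ ω = e})
    (hσunif : ∀ e : Equiv.Perm (Fin N'),
      P {ω | σ ω = e} = 1 / (Nat.factorial N' : ℝ≥0∞))
    (hindep : ∀ (e : Equiv.Perm (Fin N')) (S : Set (ℕ → ℕ)), MeasurableSet S →
      P ({ω | σ ω = e} ∩ ν ⁻¹' S) = P {ω | σ ω = e} * P (ν ⁻¹' S))
    (Q : (ℕ → ℕ) → Equiv.Perm (Fin N') → Prop) (hQ : ∀ e, MeasurableSet {v | Q v e})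
    (τ : Equiv.Perm (Fin N')) :
    P {ω | Q (ν ω) (σ ω * τ)} = P {ω | Q (ν ω) (σ ω)} := by
  rw [prob_sum P N' ν hνmeas σ hσmeas hσunif hindep Q hQ,
    prob_sum P N' ν hνmeas σ hσmeas hσunif hindep (fun v e => Q v (e * τ)) (fun e => hQ _)]
  exact Fintype.sum_equiv (Equiv.mulRight τ) _ _ (fun e => rfl)

theorem meas_F {Ω : Type*} [MeasurableSpace Ω] (N' : ℕ)
    (ν : Ω → ℕ → ℕ) (hνmeas : Measurable ν)
    (σ : Ω → Equiv.Perm (Fin N'))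
    (hσmeas : ∀ e, MeasurableSet {ω | σ ω = e}) (i : ℕ) :
    Measurable (fun ω => parentMap (ν ω) (permVal (σ ω) i)) := by
  apply measurable_to_countable'
  intro n
  have : (fun ω => parentMap (ν ω) (permVal (σ ω) i)) ⁻¹' {n} =
      ⋃ e : Equiv.Perm (Fin N'), ({ω | σ ω = e} ∩
        ν ⁻¹' ((fun v => parentMap v (permVal e i)) ⁻¹' {n})) := by
    ext ω; simp
  rw [this]
  exact MeasurableSet.iUnion fun e => (hσmeas e).inter
    (hνmeas (meas_parent _ (measurableSet_singleton n)))

theorem exists_perm {M k : ℕ} (hk : k ≤ M) (g : Fin k → Fin M) (hg : Function.Injective g) :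
    ∃ τ : Equiv.Perm (Fin M), ∀ i : Fin k, τ (Fin.castLE hk i) = g i := by
  have := Equiv.Perm.isMultiplyPretransitive (Fin M) k
  obtain ⟨τ, h⟩ := this.exists_smul_eq (Fin.castLEEmb hk) ⟨g, hg⟩
  exact ⟨τ, fun i => by simpa using DFunLike.congr_fun h i⟩

theorem abstract_ineq {Ω : Type*} [MeasurableSpace Ω] (P : Measure Ω) [IsProbabilityMeasure P]
    (F : ℕ → Ω → ℕ) (hF : ∀ i, Measurable (F i)) (M : ℕ) (a b c : ℝ)
    (ha : ∀ i j, i < M → j < M → i ≠ j → P.real {ω | F i ω = F j ω} = a)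
    (hb : ∀ i j k, i < M → j < M → k < M → i ≠ j → i ≠ k → j ≠ k →
      P.real {ω | F i ω = F j ω ∧ F j ω = F k ω} = b)
    (hc : ∀ i j k l, i < M → j < M → k < M → l < M → i ≠ j → i ≠ k → i ≠ l → j ≠ k → j ≠ l →
      k ≠ l → P.real {ω | F i ω = F j ω ∧ F k ω = F l ω} = c)
    (hb0 : 0 ≤ b) (m : ℕ) (hm : m ≤ M) :
    (m.choose 2 : ℝ) * a - 3 * (m.choose 3 : ℝ) * b - 6 * (m.choose 4 : ℝ) * c
      ≤ P.real {ω | ∃ i j, i < j ∧ j < m ∧ F i ω = F j ω} := by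
  induction m with
  | zero => simp
  | succ m ih =>
    have ih := ih (by omega)
    set E : Set Ω := {ω | ∃ i j, i < j ∧ j < m ∧ F i ω = F j ω} with hE
    have hEm : MeasurableSet E := by
      have : E = ⋃ i, ⋃ j, ⋃ (_ : i < j ∧ j < m), {ω | F i ω = F j ω} := by
        ext ω; simp [hE, and_assoc]
      rw [this]
      exact .iUnion fun i => .iUnion fun j => .iUnion fun _ => measurableSet_eq_fun (hF i) (hF j)
    set A : ℕ → Set Ω := fun i => {ω | F i ω = F m ω} with hA
    have hAm : ∀ i, MeasurableSet (A i) := fun i => measurableSet_eq_fun (hF i) (hF m)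
    -- main lower bound
    have h1 : P.real E + ∑ i ∈ Finset.range m, P.real (A i \ E) ≤
        P.real {ω | ∃ i j, i < j ∧ j < m + 1 ∧ F i ω = F j ω} := by
      rw [← measureReal_biUnion_finset, ← measureReal_union (h₁ := measure_ne_top _ _) (h₂ := measure_ne_top _ _)]
      · refine measureReal_mono ?_ (measure_ne_top _ _)
        rintro ω (⟨i, j, h1, h2, h3⟩ | h)
        · exact ⟨i, j, h1, by omega, h3⟩
        · simp only [Set.mem_iUnion, Finset.mem_range] at h
          obtain ⟨i, hi, h, _⟩ := h
          exact ⟨i, m, hi, by omega, h⟩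
      · rw [Set.disjoint_left]
        intro ω h1 h
        simp only [Set.mem_iUnion] at h
        obtain ⟨i, hi, h, h2⟩ := h
        exact h2 h1
      · exact Finset.measurableSet_biUnion _ fun i _ => (hAm i).diff hEm
      · intro i hi j hj hij
        apply Set.disjoint_left.mpr
        rintro ω ⟨h1, h2⟩ ⟨h3, _⟩
        simp only [Finset.coe_range, Set.mem_Iio] at hi hj
        apply h2
        have h4 : F i ω = F j ω := h1.trans h3.symm
        rcases lt_or_gt_of_ne hij with h | h
        · exact ⟨i, j, h, hj, h4⟩
        · exact ⟨j, i, h, hi, h4.symm⟩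
      · exact fun i _ => (hAm i).diff hEm
    have h2 : ∀ i ∈ Finset.range m, a - ((m:ℝ) - 1) * b - ((m:ℝ)-1) * ((m:ℝ)-2) * c
        ≤ P.real (A i \ E) := by
      intro i hi
      have hi' := Finset.mem_range.mp hi
      have e1 : P.real (A i) = a := ha i m (by omega) (by omega) (by omega)
      have e2 := measureReal_sdiff_add_inter (μ := P) (s := A i) hEm
      have e3 : P.real (A i ∩ E) ≤ ((m:ℝ) - 1) * b + ((m:ℝ)-1) * ((m:ℝ)-2) * c := by
        have hsub : A i ∩ E ⊆
            (⋃ j ∈ (Finset.range m).erase i, {ω | F j ω = F i ω ∧ F i ω = F m ω}) ∪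
            (⋃ j ∈ (Finset.range m).erase i, ⋃ k ∈ ((Finset.range m).erase i).erase j,
              {ω | F i ω = F m ω ∧ F j ω = F k ω}) := by
          rintro ω ⟨h1, j, k, hjk, hk, h2⟩
          have h1 : F i ω = F m ω := h1
          simp only [Set.mem_union, Set.mem_iUnion, Finset.mem_erase, Finset.mem_range,
            Set.mem_ofPred_eq, exists_prop]
          by_cases hj : j = i
          · subst hj
            exact Or.inl ⟨k, ⟨by omega, hk⟩, h2.symm, h1⟩
          · by_cases hki : k = i
            · subst hki
              exact Or.inl ⟨j, ⟨by omega, by omega⟩, h2, h1⟩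
            · exact Or.inr ⟨j, ⟨hj, by omega⟩, k, ⟨by omega, hki, hk⟩, h1, h2⟩
        refine (measureReal_mono hsub).trans ((measureReal_union_le _ _).trans (add_le_add ?_ ?_))
        · refine (measureReal_biUnion_finset_le _ _).trans ?_
          rw [Finset.sum_congr rfl (g := fun _ => b)]
          · simp only [Finset.sum_const, Finset.card_erase_of_mem hi, Finset.card_range,
              nsmul_eq_mul]
            rw [Nat.cast_sub (by omega)]; simp
          · intro j hj
            simp only [Finset.mem_erase, Finset.mem_range] at hj
            exact hb j i m (by omega) (by omega) (by omega) (by omega) (by omega) (by omega)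
        · refine (measureReal_biUnion_finset_le _ _).trans ?_
          have : ∀ j ∈ (Finset.range m).erase i,
              P.real (⋃ k ∈ ((Finset.range m).erase i).erase j,
              {ω | F i ω = F m ω ∧ F j ω = F k ω}) ≤ ((m:ℝ)-2) * c := by
            intro j hj
            refine (measureReal_biUnion_finset_le _ _).trans ?_
            have hj' := hj
            simp only [Finset.mem_erase, Finset.mem_range] at hj'
            rw [Finset.sum_congr rfl (g := fun _ => c)]
            · simp only [Finset.sum_const, Finset.card_erase_of_mem hj,
                Finset.card_erase_of_mem hi, Finset.card_range, nsmul_eq_mul]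
              rw [Nat.sub_sub, Nat.cast_sub (by omega)]; norm_num
            · intro k hk
              simp only [Finset.mem_erase, Finset.mem_range] at hk
              exact hc i m j k (by omega) (by omega) (by omega) (by omega) (by omega) (by omega)
                (by omega) (by omega) (by omega) (by omega)
          refine (Finset.sum_le_sum this).trans ?_
          simp only [Finset.sum_const, Finset.card_erase_of_mem hi, Finset.card_range,
              nsmul_eq_mul]
          rw [Nat.cast_sub (by omega)]; simp [mul_assoc]
      linarith
    have h3 := Finset.sum_le_sum h2
    simp only [Finset.sum_const, Finset.card_range, nsmul_eq_mul] at h3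
    have c2 : (((m+1).choose 2 : ℕ) : ℝ) = m + m.choose 2 := by
      rw [Nat.choose_succ_succ' m 1]; simp
    have c3 : (((m+1).choose 3 : ℕ) : ℝ) = m * (m-1) / 2 + m.choose 3 := by
      rw [Nat.choose_succ_succ' m 2]; push_cast [Nat.cast_choose_two]; ring
    have c4 : (((m+1).choose 4 : ℕ) : ℝ) = m * (m-1) * (m-2) / 6 + m.choose 4 := by
      rw [Nat.choose_succ_succ' m 3]
      have : ((m.choose 3 : ℕ) : ℝ) = m * (m-1) * (m-2) / 6 := by
        rw [Nat.cast_choose_eq_ascPochhammer_div]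
        rcases m with _ | _ | m
        · simp
        · simp
        · simp [ascPochhammer_succ_right, Nat.factorial]
          ring
      push_cast [this]; ring
    rw [c2, c3, c4]
    have h5 : 0 ≤ (m:ℝ) * (m - 1) * b := by
      apply mul_nonneg _ hb0
      rcases m with _ | m
      · simp
      · push_cast; simp; positivity
    nlinarith

/-- Suppose `N' ≥ 4`.  For `2 ≤ m ≤ N'`,
`P(#{𝔭(u_1),…,𝔭(u_m)} ≤ m−1)
  ≥ C(m,2)·P(𝔭(u_1)=𝔭(u_2)) − 3·C(m,3)·P(𝔭(u_1)=𝔭(u_2)=𝔭(u_3))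
    − 6·C(m,4)·P(𝔭(u_1)=𝔭(u_2) ∧ 𝔭(u_3)=𝔭(u_4))`.
(Indices of `u` are shifted to be `0`-based.) -/
theorem coalescent_collision_inclusion_exclusion
    {Ω : Type*} [MeasurableSpace Ω] (P : Measure Ω) [IsProbabilityMeasure P]
    (N N' : ℕ) (hN : 0 < N) (hN' : 4 ≤ N')
    (ν : Ω → ℕ → ℕ) (hνmeas : Measurable ν)
    (hsum : ∀ᵐ ω ∂P, ∑ i ∈ Finset.range N, ν ω i = N')
    (hexch : ∀ π : Equiv.Perm (Fin N),
      Measure.map (fun ω => fun i : Fin N => ν ω (π i)) P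
        = Measure.map (fun ω => fun i : Fin N => ν ω i) P)
    (σ : Ω → Equiv.Perm (Fin N'))
    (hσmeas : ∀ e, MeasurableSet {ω | σ ω = e})
    (hσunif : ∀ e : Equiv.Perm (Fin N'),
      P {ω | σ ω = e} = 1 / (Nat.factorial N' : ℝ≥0∞))
    (hindep : ∀ (e : Equiv.Perm (Fin N')) (S : Set (ℕ → ℕ)), MeasurableSet S →
      P ({ω | σ ω = e} ∩ ν ⁻¹' S) = P {ω | σ ω = e} * P (ν ⁻¹' S))
    (m : ℕ) (hm : 2 ≤ m) (hmN' : m ≤ N') :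
    (P {ω | ((Finset.range m).image
        (fun i => parentMap (ν ω) (permVal (σ ω) i))).card ≤ m - 1}).toReal
      ≥ (m.choose 2 : ℝ) *
          (P {ω | parentMap (ν ω) (permVal (σ ω) 0)
                = parentMap (ν ω) (permVal (σ ω) 1)}).toReal
        - 3 * (m.choose 3 : ℝ) *
            (P {ω | parentMap (ν ω) (permVal (σ ω) 0)
                  = parentMap (ν ω) (permVal (σ ω) 1)
                ∧ parentMap (ν ω) (permVal (σ ω) 1)
                  = parentMap (ν ω) (permVal (σ ω) 2)}).toReal
        - 6 * (m.choose 4 : ℝ) *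
            (P {ω | parentMap (ν ω) (permVal (σ ω) 0)
                  = parentMap (ν ω) (permVal (σ ω) 1)
                ∧ parentMap (ν ω) (permVal (σ ω) 2)
                  = parentMap (ν ω) (permVal (σ ω) 3)}).toReal := by
  have hinv := prob_inv P N' ν hνmeas σ hσmeas hσunif hindep
  have hmF : ∀ i, Measurable (fun ω => parentMap (ν ω) (permVal (σ ω) i)) :=
    meas_F N' ν hνmeas σ hσmeas
  have hpe : ∀ (e : Equiv.Perm (Fin N')) (i j : ℕ),
      MeasurableSet {v : ℕ → ℕ | parentMap v (permVal e i) = parentMap v (permVal e j)} :=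
    fun e i j => measurableSet_eq_fun (meas_parent _) (meas_parent _)
  have hpv : ∀ (e τ : Equiv.Perm (Fin N')) (i j : ℕ) (hi : i < N') (hj : j < N'),
      τ ⟨i, hi⟩ = ⟨j, hj⟩ → permVal (e * τ) i = permVal e j := by
    intro e τ i j hi hj h
    simp [permVal, hi, hj, h]
  have key := abstract_ineq P (fun i ω => parentMap (ν ω) (permVal (σ ω) i)) hmF N'
    (P.real {ω | parentMap (ν ω) (permVal (σ ω) 0) = parentMap (ν ω) (permVal (σ ω) 1)})
    (P.real {ω | parentMap (ν ω) (permVal (σ ω) 0) = parentMap (ν ω) (permVal (σ ω) 1)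
      ∧ parentMap (ν ω) (permVal (σ ω) 1) = parentMap (ν ω) (permVal (σ ω) 2)})
    (P.real {ω | parentMap (ν ω) (permVal (σ ω) 0) = parentMap (ν ω) (permVal (σ ω) 1)
      ∧ parentMap (ν ω) (permVal (σ ω) 2) = parentMap (ν ω) (permVal (σ ω) 3)})
    ?_ ?_ ?_ measureReal_nonneg m hmN'
  · have hset : {ω | ((Finset.range m).image
        (fun i => parentMap (ν ω) (permVal (σ ω) i))).card ≤ m - 1} =
        {ω | ∃ i j, i < j ∧ j < m ∧
          parentMap (ν ω) (permVal (σ ω) i) = parentMap (ν ω) (permVal (σ ω) j)} := by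
      ext ω
      simp only [Set.mem_ofPred_eq]
      constructor
      · intro h
        by_contra hcon
        push Not at hcon
        have hinj : Set.InjOn (fun i => parentMap (ν ω) (permVal (σ ω) i))
            (Finset.range m : Set ℕ) := by
          intro i hi j hj hij
          simp only [Finset.coe_range, Set.mem_Iio] at hi hj
          by_contra hne
          rcases lt_or_gt_of_ne hne with h | h
          · exact hcon i j h hj hij
          · exact hcon j i h hi hij.symm
        rw [Finset.card_image_of_injOn hinj, Finset.card_range] at h
        omega
      · rintro ⟨i, j, hij, hj, h⟩
        by_contra hcon
        have hle := Finset.card_image_le (s := Finset.range m)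
          (f := fun i => parentMap (ν ω) (permVal (σ ω) i))
        rw [Finset.card_range] at hle
        have heq : ((Finset.range m).image
          (fun i => parentMap (ν ω) (permVal (σ ω) i))).card = (Finset.range m).card := by
          rw [Finset.card_range]; omega
        have hinj := Finset.card_image_iff.mp heq
        have : i = j := hinj (by simp; omega) (by simp; omega) h
        omega
    rw [hset]
    exact key
  · intro i j hi hj hij
    obtain ⟨τ, hτ⟩ := exists_perm (k := 2) (by omega) ![(⟨i, hi⟩ : Fin N'), ⟨j, hj⟩] (by
      intro x y; fin_cases x <;> fin_cases y <;> simp <;> omega)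
    have t0 := fun e => hpv e τ 0 i (by omega) hi (hτ 0)
    have t1 := fun e => hpv e τ 1 j (by omega) hj (hτ 1)
    have := hinv (fun v e => parentMap v (permVal e 0) = parentMap v (permVal e 1))
      (fun e => hpe e 0 1) τ
    simp only [t0, t1] at this
    simp only [measureReal_def, this]
  · intro i j k hi hj hk hij hik hjk
    obtain ⟨τ, hτ⟩ := exists_perm (k := 3) (by omega)
      ![(⟨i, hi⟩ : Fin N'), ⟨j, hj⟩, ⟨k, hk⟩] (by
      intro x y; fin_cases x <;> fin_cases y <;> simp <;> omega)
    have t0 := fun e => hpv e τ 0 i (by omega) hi (hτ 0)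
    have t1 := fun e => hpv e τ 1 j (by omega) hj (hτ 1)
    have t2 := fun e => hpv e τ 2 k (by omega) hk (hτ 2)
    have := hinv (fun v e => parentMap v (permVal e 0) = parentMap v (permVal e 1) ∧
      parentMap v (permVal e 1) = parentMap v (permVal e 2))
      (fun e => (hpe e 0 1).inter (hpe e 1 2)) τ
    simp only [t0, t1, t2] at this
    simp only [measureReal_def, this]
  · intro i j k l hi hj hk hl hij hik hil hjk hjl hkl
    obtain ⟨τ, hτ⟩ := exists_perm (k := 4) (by omega)
      ![(⟨i, hi⟩ : Fin N'), ⟨j, hj⟩, ⟨k, hk⟩, ⟨l, hl⟩] (by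
      intro x y; fin_cases x <;> fin_cases y <;> simp <;> omega)
    have t0 := fun e => hpv e τ 0 i (by omega) hi (hτ 0)
    have t1 := fun e => hpv e τ 1 j (by omega) hj (hτ 1)
    have t2 := fun e => hpv e τ 2 k (by omega) hk (hτ 2)
    have t3 := fun e => hpv e τ 3 l (by omega) hl (hτ 3)
    have := hinv (fun v e => parentMap v (permVal e 0) = parentMap v (permVal e 1) ∧
      parentMap v (permVal e 2) = parentMap v (permVal e 3))
      (fun e => (hpe e 0 1).inter (hpe e 2 3)) τ
    simp only [t0, t1, t2, t3] at this
    simp only [measureReal_def, this]
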